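/- arXiv:2012.11978 — 7 statements merged into one kernel-verified Lean document; each statement's English description precedes it below -/
import Mathlib

section
/- Let Ω ⊂ ℝ^d be a bounded open set, s ∈ ℕ, and let f ∈ C^{s+2}(ℝ^d) satisfy the geometric assumption on Ω. Then there exist p ∈ ℕ₊ and functions w₁,…,w_p ∈ C^s(ℝ^d) such that f(x) − f* = ∑_{j=1}^p wⱼ(x)² for all x ∈ Ω. -/
open Metric Set MeasureTheory
open scoped RealInnerProductSpace

noncomputable section

abbrev Euc (d : ℕ) := EuclideanSpace ℝ (Fin d)

/-- The set of global minimizers of `f` on the closure of `Ω`. -/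
def minimizerSet {d : ℕ} (Ω : Set (Euc d)) (f : Euc d → ℝ) : Set (Euc d) :=
  {x ∈ closure Ω | f x = sInf (f '' closure Ω)}

/-- The geometric assumption: the set of minimizers of `f` over `cl Ω` is nonempty,
finite, contained in the open set `Ω`, and at every minimizer the Hessian of `f` is
positive definite. -/
def GeomAssumption {d : ℕ} (Ω : Set (Euc d)) (f : Euc d → ℝ) : Prop :=
  (minimizerSet Ω f).Nonempty ∧ (minimizerSet Ω f).Finite ∧ minimizerSet Ω f ⊆ Ω ∧
    ∀ ζ ∈ minimizerSet Ω f, ∀ v : Euc d, v ≠ 0 → 0 < iteratedFDeriv ℝ 2 f ζ ![v, v]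

open scoped Topology

universe u

set_option maxSynthPendingDepth 4 in
set_option synthInstance.maxHeartbeats 200000 in
/-- Weighted averages along the segments issued from a point `c` preserve `C^n` regularity. -/
theorem contDiff_integral_segment {E : Type u} [NormedAddCommGroup E] [NormedSpace ℝ E]
    [ProperSpace E] (c : E) (n : ℕ) {G : Type u} [NormedAddCommGroup G] [NormedSpace ℝ G]
    {φ : ℝ → ℝ} (hφ : Continuous φ) {F : E → G} (hF : ContDiff ℝ n F) :
    ContDiff ℝ n (fun x => ∫ t in (0 : ℝ)..1, φ t • F (c + t • (x - c))) := by
  induction n generalizing G φ with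
  | zero =>
    have hFc := hF.continuous
    refine contDiff_zero.2
      (intervalIntegral.continuous_parametric_intervalIntegral_of_continuous' ?_ 0 1)
    fun_prop
  | succ n ih =>
    have hF1 : ContDiff ℝ 1 F := hF.of_le (by norm_cast; omega)
    have hFc := hF1.continuous
    have hF' : ContDiff ℝ n (fderiv ℝ F) := hF.fderiv_right (by norm_cast)
    have hF'c := hF'.continuous
    rw [Nat.cast_add, Nat.cast_one, contDiff_succ_iff_hasFDerivAt]
    refine ⟨_, ih (φ := fun t => φ t * t) (by fun_prop) hF', fun x₀ => ?_⟩
    set F' : E → ℝ → E →L[ℝ] G :=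
      fun x t => (φ t * t) • fderiv ℝ F (c + t • (x - c)) with hF'def
    have hF'cont : Continuous (fun p : E × ℝ => F' p.1 p.2) := by fun_prop
    obtain ⟨C, hC⟩ := ((isCompact_closedBall x₀ 1).prod
      (isCompact_Icc (a := (0 : ℝ)) (b := 1))).exists_bound_of_continuousOn hF'cont.continuousOn
    refine intervalIntegral.hasFDerivAt_integral_of_dominated_of_fderiv_le
      (F := fun x t => φ t • F (c + t • (x - c))) (F' := F') (bound := fun _ => C)
      (closedBall_mem_nhds x₀ one_pos) ?_ ?_ ?_ ?_ ?_ ?_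
    · refine Filter.Eventually.of_forall fun x => Continuous.aestronglyMeasurable ?_
      fun_prop
    · refine Continuous.intervalIntegrable ?_ _ _
      fun_prop
    · exact Continuous.aestronglyMeasurable (by fun_prop)
    · refine Filter.Eventually.of_forall fun t ht x hx => hC (x, t) ⟨hx, ?_⟩
      rw [uIoc_of_le zero_le_one] at ht
      exact ⟨ht.1.le, ht.2⟩
    · exact intervalIntegrable_const
    · refine Filter.Eventually.of_forall fun t _ x _ => ?_
      have h1 : HasFDerivAt (fun x => c + t • (x - c)) (t • ContinuousLinearMap.id ℝ E) x :=
        (((hasFDerivAt_id x).sub_const c).const_smul t).const_add c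
      have h2 := (hF1.differentiable one_ne_zero (c + t • (x - c))).hasFDerivAt.comp x h1
      refine (h2.const_smul (φ t)).congr_fderiv ?_
      rw [ContinuousLinearMap.comp_smul, ContinuousLinearMap.comp_id, smul_smul]

set_option maxSynthPendingDepth 4 in
set_option synthInstance.maxHeartbeats 200000 in
/-- Second order Taylor formula with integral remainder. -/
theorem ContDiff.taylor_two_integral {E : Type u} [NormedAddCommGroup E] [NormedSpace ℝ E]
    {f : E → ℝ} (hf : ContDiff ℝ 2 f) (c x : E) :
    f x - f c - fderiv ℝ f c (x - c) =
      (∫ t in (0 : ℝ)..1, (1 - t) • fderiv ℝ (fderiv ℝ f) (c + t • (x - c))) (x - c) (x - c) := by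
  have hf' : ContDiff ℝ 1 (fderiv ℝ f) := hf.fderiv_right (by norm_num)
  have hf'' : Continuous (fderiv ℝ (fderiv ℝ f)) := hf'.continuous_fderiv one_ne_zero
  have hline : ∀ t : ℝ, HasDerivAt (fun t : ℝ => c + t • (x - c)) (x - c) t := fun t => by
    simpa using ((hasDerivAt_id t).smul_const (x - c)).const_add c
  have h0 : ∀ t : ℝ, HasDerivAt (fun t : ℝ => f (c + t • (x - c)))
      (fderiv ℝ f (c + t • (x - c)) (x - c)) t := fun t =>
    (hf.differentiable two_ne_zero _).hasFDerivAt.comp_hasDerivAt t (hline t)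
  have h1 : ∀ t : ℝ, HasDerivAt (fun t : ℝ => fderiv ℝ f (c + t • (x - c)) (x - c))
      (fderiv ℝ (fderiv ℝ f) (c + t • (x - c)) (x - c) (x - c)) t := fun t => by
    have := ((hf'.differentiable one_ne_zero _).hasFDerivAt.comp_hasDerivAt t (hline t)).clm_apply
      (hasDerivAt_const t (x - c))
    simpa using this
  have h2 : ∀ t : ℝ, HasDerivAt
      (fun t : ℝ => (1 - t) * fderiv ℝ f (c + t • (x - c)) (x - c) + f (c + t • (x - c)))
      ((1 - t) * fderiv ℝ (fderiv ℝ f) (c + t • (x - c)) (x - c) (x - c)) t := fun t => by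
    refine ((((hasDerivAt_id t).const_sub 1).mul (h1 t)).add (h0 t)).congr_deriv ?_
    rw [id_eq]
    ring
  have hint : IntervalIntegrable
      (fun t : ℝ => (1 - t) • fderiv ℝ (fderiv ℝ f) (c + t • (x - c))) volume 0 1 :=
    Continuous.intervalIntegrable (by fun_prop) _ _
  have hint' : IntervalIntegrable
      (fun t : ℝ => (1 - t) • fderiv ℝ (fderiv ℝ f) (c + t • (x - c)) (x - c)) volume 0 1 :=
    Continuous.intervalIntegrable (by fun_prop) _ _
  rw [ContinuousLinearMap.intervalIntegral_apply hint]
  simp only [smul_apply]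
  rw [ContinuousLinearMap.intervalIntegral_apply hint']
  simp only [smul_apply, smul_eq_mul]
  rw [intervalIntegral.integral_eq_sub_of_hasDerivAt (fun t _ => h2 t)
    (Continuous.intervalIntegrable (by fun_prop) _ _)]
  simp
  ring

/-- `g` is, near `x`, a finite sum of squares of functions that are `C^n` near `x`. -/
def LocallySumSq {E : Type u} [NormedAddCommGroup E] [NormedSpace ℝ E] (n : ℕ) (g : E → ℝ)
    (x : E) : Prop :=
  ∃ (p : ℕ) (w : Fin p → E → ℝ), ∀ᶠ y in 𝓝 x, (∀ j, ContDiffAt ℝ n (w j) y) ∧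
    g y = ∑ j, w j y ^ 2

theorem LocallySumSq.of_fintype {E : Type u} [NormedAddCommGroup E] [NormedSpace ℝ E] {n : ℕ}
    {g : E → ℝ} {x : E} {ι : Type*} [Fintype ι] (w : ι → E → ℝ)
    (hw : ∀ᶠ y in 𝓝 x, (∀ j, ContDiffAt ℝ n (w j) y) ∧ g y = ∑ j, w j y ^ 2) :
    LocallySumSq n g x := by
  refine ⟨Fintype.card ι, fun j => w ((Fintype.equivFin ι).symm j), ?_⟩
  filter_upwards [hw] with y hy
  refine ⟨fun j => hy.1 _, ?_⟩
  rw [hy.2]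
  exact ((Fintype.equivFin ι).symm.sum_comp (fun i => w i y ^ 2)).symm

theorem locallySumSq_of_pos {E : Type u} [NormedAddCommGroup E] [NormedSpace ℝ E] {n : ℕ}
    {g : E → ℝ} (hg : ContDiff ℝ n g) {x : E} (hx : 0 < g x) : LocallySumSq n g x := by
  refine ⟨1, fun _ y => √(g y), ?_⟩
  filter_upwards [hg.continuous.continuousAt.eventually_const_lt hx] with y hy
  exact ⟨fun _ => hg.contDiffAt.sqrt hy.ne', by simp [Real.sq_sqrt hy.le]⟩

/-- A quadratic form whose coefficients vary in a `C^n` way, and which is diagonal and positive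
definite at one point, is a sum of squares of `C^n` functions near that point. -/
theorem locallySumSq_of_diagonal {E : Type u} [NormedAddCommGroup E] [NormedSpace ℝ E]
    {n : ℕ} {ι : Type*} [Fintype ι] [DecidableEq ι] {g : E → ℝ} {x : E}
    {M : ι → ι → E → ℝ} (hM : ∀ i j, ContDiff ℝ n (M i j)) {Y : ι → E → ℝ}
    (hY : ∀ i, ContDiff ℝ n (Y i)) (hg : ∀ y, g y = ∑ i, ∑ j, M i j y * Y i y * Y j y)
    (hpos : ∀ i, 0 < M i i x) (hdiag : ∀ i j, i ≠ j → M i j x = 0) :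
    LocallySumSq n g x := by
  set N : ℝ := (Fintype.card ι : ℝ) with hN
  obtain ⟨c, hc, hcM⟩ : ∃ c : ℝ, 0 < c ∧ ∀ i, 0 < M i i x - c * N := by
    have key : ∀ᶠ c in 𝓝[>] (0 : ℝ), ∀ i, 0 < M i i x - c * N := by
      refine Filter.eventually_all.2 fun i => nhdsWithin_le_nhds ?_
      have : ContinuousAt (fun c : ℝ => M i i x - c * N) 0 := by fun_prop
      exact this.eventually_const_lt (by simpa using hpos i)
    obtain ⟨c, h1, h2⟩ := (key.and self_mem_nhdsWithin).exists
    exact ⟨c, h2, h1⟩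
  obtain ⟨D, hD⟩ : ∃ D : ι → ι → ℝ, ∀ i j, M i j x = D i j := ⟨_, fun _ _ => rfl⟩
  simp only [hD] at hcM hdiag
  have hsmall : ∀ᶠ y in 𝓝 x, ∀ i j, |M i j y - D i j| < c := by
    refine Filter.eventually_all.2 fun i => Filter.eventually_all.2 fun j => ?_
    have : ContinuousAt (fun y => |M i j y - D i j|) x :=
      (((hM i j).continuous.sub continuous_const).abs).continuousAt
    exact this.eventually_lt_const (by simpa [hD] using hc)
  refine LocallySumSq.of_fintype (ι := ι ⊕ (ι × ι) ⊕ (ι × ι))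
    (Sum.elim (fun i y => √(D i i - c * N) * Y i y) (Sum.elim
      (fun q y => √((c + (M q.1 q.2 y - D q.1 q.2)) / 4) * (Y q.1 y + Y q.2 y))
      (fun q y => √((c - (M q.1 q.2 y - D q.1 q.2)) / 4) * (Y q.1 y - Y q.2 y)))) ?_
  filter_upwards [hsmall] with y hy
  have hp : ∀ i j, 0 < (c + (M i j y - D i j)) / 4 := fun i j => by
    linarith [(abs_lt.1 (hy i j)).1]
  have hm : ∀ i j, 0 < (c - (M i j y - D i j)) / 4 := fun i j => by
    linarith [(abs_lt.1 (hy i j)).2]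
  constructor
  · rintro (i | q | q)
    · exact contDiffAt_const.mul (hY i).contDiffAt
    · exact ((((contDiffAt_const.add ((hM _ _).contDiffAt.sub contDiffAt_const)).div_const _).sqrt
        (hp _ _).ne')).mul ((hY _).contDiffAt.add (hY _).contDiffAt)
    · exact ((((contDiffAt_const.sub ((hM _ _).contDiffAt.sub contDiffAt_const)).div_const _).sqrt
        (hm _ _).ne')).mul ((hY _).contDiffAt.sub (hY _).contDiffAt)
  · simp only [Fintype.sum_sum_type, Sum.elim_inl, Sum.elim_inr, mul_pow,
      Real.sq_sqrt (hcM _).le, Real.sq_sqrt (hp _ _).le, Real.sq_sqrt (hm _ _).le,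
      Fintype.sum_prod_type]
    have hdiagsum : ∀ i, ∑ j, D i j * Y i y * Y j y = D i i * Y i y ^ 2 := fun i => by
      rw [Finset.sum_eq_single i (fun j _ hj => by simp [hdiag i j hj.symm])
        (fun h => absurd (Finset.mem_univ i) h)]
      ring
    have hsq : ∑ i, ∑ j, c / 2 * (Y i y ^ 2 + Y j y ^ 2) = ∑ i, c * N * Y i y ^ 2 := by
      simp only [mul_add, Finset.sum_add_distrib, Finset.sum_const, Finset.card_univ,
        nsmul_eq_mul, ← hN, ← Finset.mul_sum]
      ring
    rw [hg, ← Finset.sum_add_distrib]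
    calc ∑ i, ∑ j, M i j y * Y i y * Y j y
        = ∑ i, ((D i i - c * N) * Y i y ^ 2) + (∑ i, ∑ j, c / 2 * (Y i y ^ 2 + Y j y ^ 2)
          + ∑ i, ∑ j, (M i j y - D i j) * Y i y * Y j y) := by
          rw [hsq, ← Finset.sum_add_distrib, ← Finset.sum_add_distrib]
          refine Finset.sum_congr rfl fun i _ => ?_
          simp only [sub_mul, Finset.sum_sub_distrib, hdiagsum]
          ring
      _ = _ := by
          congr 1
          simp only [← Finset.sum_add_distrib]
          refine Finset.sum_congr rfl fun i _ => Finset.sum_congr rfl fun j _ => ?_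
          ring

set_option maxSynthPendingDepth 4 in
set_option synthInstance.maxHeartbeats 200000 in
/-- Near a nondegenerate local minimum of a `C^{n+2}` function `f`, the difference of `f` and its
minimal value is a sum of squares of `C^n` functions. -/
theorem locallySumSq_of_isLocalMin {E : Type u} [NormedAddCommGroup E] [NormedSpace ℝ E]
    [FiniteDimensional ℝ E] {n : ℕ} {f : E → ℝ} (hf : ContDiff ℝ (n + 2 : ℕ) f) {c : E}
    (hc : IsLocalMin f c) (hpos : ∀ v : E, v ≠ 0 → 0 < fderiv ℝ (fderiv ℝ f) c v v) :
    LocallySumSq n (fun y => f y - f c) c := by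
  have : ProperSpace E := FiniteDimensional.proper_real E
  have hf2 : ContDiff ℝ 2 f := hf.of_le (by norm_cast; omega)
  have hf1 : ContDiff ℝ (n + 1 : ℕ) (fderiv ℝ f) := hf.fderiv_right (by norm_cast)
  have hf'' : ContDiff ℝ n (fderiv ℝ (fderiv ℝ f)) := hf1.fderiv_right (by norm_cast)
  set Q : E → E →L[ℝ] E →L[ℝ] ℝ :=
    fun y => ∫ t in (0 : ℝ)..1, (1 - t) • fderiv ℝ (fderiv ℝ f) (c + t • (y - c)) with hQ
  have hQd : ContDiff ℝ n Q :=
    contDiff_integral_segment c n (φ := fun t => 1 - t) (by fun_prop) hf''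
  have hQc : Q c = (1 / 2 : ℝ) • fderiv ℝ (fderiv ℝ f) c := by
    simp only [hQ, sub_self, smul_zero, add_zero]
    rw [intervalIntegral.integral_smul_const]
    congr 1
    rw [intervalIntegral.integral_sub (by simp) (by simp)]
    simp
    norm_num
  have hfQ : ∀ y, f y - f c = Q y (y - c) (y - c) := fun y => by
    rw [← hf2.taylor_two_integral c y, hc.fderiv_eq_zero]
    simp
  let B : LinearMap.BilinForm ℝ E := LinearMap.mk₂ ℝ (fun v w => Q c v w)
    (by simp) (by simp) (by simp) (by simp)
  have hB : LinearMap.IsSymm B := ⟨fun v w => by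
    have := (hf2.contDiffAt (x := c)).isSymmSndFDerivAt (by simp) v w
    simp [B, hQc, this]⟩
  have : Invertible (2 : ℝ) := invertibleOfNonzero two_ne_zero
  obtain ⟨b, hb⟩ := LinearMap.BilinForm.exists_orthogonal_basis hB
  refine locallySumSq_of_diagonal (M := fun i j y => Q y (b i) (b j))
    (Y := fun i y => b.repr (y - c) i) (fun i j => ?_) (fun i => ?_) (fun y => ?_) (fun i => ?_)
    (fun i j hij => hb hij)
  · exact (hQd.clm_apply contDiff_const).clm_apply contDiff_const
  · have : ContDiff ℝ n (LinearMap.toContinuousLinearMap (b.coord i)) :=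
      ContinuousLinearMap.contDiff _
    exact this.comp (contDiff_id.sub contDiff_const)
  · rw [hfQ]
    conv_lhs => rw [← b.sum_repr (y - c)]
    simp only [map_sum, map_smul, sum_apply, smul_apply,
      smul_eq_mul]
    rw [Finset.sum_comm]
    refine Finset.sum_congr rfl fun i _ => ?_
    rw [Finset.mul_sum]
    refine Finset.sum_congr rfl fun j _ => ?_
    ring
  · have := hpos (b i) (b.ne_zero i)
    simp [hQc, this]

/-- A function that is locally, around each point of a compact set, a sum of squares of `C^n`
functions is on this set a sum of squares of globally defined `C^n` functions. -/
theorem IsCompact.exists_sum_sq {E : Type u} [NormedAddCommGroup E] [NormedSpace ℝ E]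
    [FiniteDimensional ℝ E] {n : ℕ} {g : E → ℝ} {K : Set E} (hK : IsCompact K)
    (hg : ∀ x ∈ K, LocallySumSq n g x) :
    ∃ (p : ℕ) (w : Fin p → E → ℝ), (∀ j, ContDiff ℝ n (w j)) ∧
      ∀ x ∈ K, g x = ∑ j, w j x ^ 2 := by
  have hbump : ∀ x ∈ K, ∃ (p : ℕ) (w : Fin p → E → ℝ) (χ : ContDiffBump x),
      ∀ y ∈ closedBall x χ.rOut, (∀ j, ContDiffAt ℝ n (w j) y) ∧ g y = ∑ j, w j y ^ 2 := by
    intro x hx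
    obtain ⟨p, w, hw⟩ := hg x hx
    obtain ⟨r, hr, hrw⟩ := Metric.nhds_basis_closedBall.eventually_iff.1 hw
    exact ⟨p, w, ⟨r / 2, r, by linarith, by linarith⟩, fun y hy => hrw hy⟩
  choose! p w χ hχ using hbump
  obtain ⟨T, hTK, hKT⟩ := hK.elim_nhds_subcover (fun x => closedBall x (χ x).rIn)
    (fun x _ => closedBall_mem_nhds x (χ x).rIn_pos)
  set S : E → ℝ := fun y => ∑ x ∈ T, (χ x y) ^ 2 with hS
  have hSd : ContDiff ℝ n S := ContDiff.sum fun x _ => (χ x).contDiff.pow 2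
  have hS0 : ∀ y, 0 ≤ S y := fun y => Finset.sum_nonneg fun x _ => sq_nonneg _
  have hS1 : ∀ y ∈ K, 1 ≤ S y := fun y hy => by
    obtain ⟨x, hxT, hyx⟩ := mem_iUnion₂.1 (hKT hy)
    have h := Finset.single_le_sum (f := fun x => (χ x y) ^ 2) (fun x _ => sq_nonneg _) hxT
    simpa [(χ x).one_of_mem_closedBall hyx] using h
  set R : E → ℝ := fun y => S y + Real.smoothTransition (1 - S y) with hR
  have hRd : ContDiff ℝ n R :=
    hSd.add (Real.smoothTransition.contDiff.comp (contDiff_const.sub hSd))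
  have hRpos : ∀ y, 0 < R y := fun y => by
    rcases lt_or_ge (S y) 1 with h | h
    · exact add_pos_of_nonneg_of_pos (hS0 y) (Real.smoothTransition.pos_of_pos (by linarith))
    · exact add_pos_of_pos_of_nonneg (by linarith) (Real.smoothTransition.nonneg _)
  have hRS : ∀ y ∈ K, R y = S y := fun y hy => by
    simp [hR, Real.smoothTransition.zero_of_nonpos (sub_nonpos.2 (hS1 y hy))]
  let ι := Σ x : T, Fin (p x)
  let e : ι ≃ Fin (Fintype.card ι) := Fintype.equivFin ι
  let W : ι → E → ℝ := fun q y => χ q.1 y * w q.1 q.2 y / √(R y)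
  refine ⟨Fintype.card ι, fun j => W (e.symm j), fun j => ?_, fun y hy => ?_⟩
  · suffices h : ∀ q, ContDiff ℝ n (W q) from h _
    rintro ⟨⟨x, hx⟩, k⟩
    refine ContDiff.div ?_ (hRd.sqrt fun y => (hRpos y).ne')
      fun y => (Real.sqrt_pos.2 (hRpos y)).ne'
    refine contDiff_iff_contDiffAt.2 fun y => ?_
    by_cases hy : y ∈ closedBall x (χ x).rOut
    · exact (χ x).contDiffAt.mul ((hχ x (hTK x hx) y hy).1 k)
    · have h0 : (χ x : E → ℝ) =ᶠ[𝓝 y] 0 := by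
        rw [← notMem_tsupport_iff_eventuallyEq, (χ x).tsupport_eq]
        exact hy
      refine (contDiffAt_const (c := (0 : ℝ))).congr_of_eventuallyEq ?_
      filter_upwards [h0] with z hz
      simp [hz]
  · rw [e.symm.sum_comp (fun q => W q y ^ 2), Fintype.sum_sigma]
    have hterm : ∀ x : T, ∑ k, W ⟨x, k⟩ y ^ 2 = (χ x y) ^ 2 * g y / S y := fun x => by
      simp only [W, div_pow, mul_pow, Real.sq_sqrt (hRpos y).le]
      rw [hRS y hy, ← Finset.sum_div, ← Finset.mul_sum]
      by_cases hxy : y ∈ closedBall (x : E) (χ x).rOut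
      · rw [(hχ x (hTK x x.2) y hxy).2]
      · have : χ (x : E) y = 0 := (χ x).zero_of_le_dist (by simpa using (not_le.1 hxy).le)
        simp [this]
    simp only [hterm]
    rw [← Finset.sum_div, ← Finset.sum_mul, Finset.sum_coe_sort T (fun x => (χ x y) ^ 2)]
    exact (mul_div_cancel_left₀ _ (by linarith [hS1 y hy])).symm

/-- If `Ω ⊂ ℝ^d` is a bounded open set, `s ∈ ℕ`, and `f ∈ C^{s+2}(ℝ^d)`
satisfies the geometric assumption on `Ω`, then `f − f*` is a finite sum of squares of
`C^s(ℝ^d)` functions on `Ω`. -/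
theorem sos_decomposition_Cs {d : ℕ} (hd : 0 < d) (s : ℕ)
    (Ω : Set (Euc d)) (hΩo : IsOpen Ω) (hΩb : Bornology.IsBounded Ω)
    (f : Euc d → ℝ) (hf : ContDiff ℝ (s + 2 : ℕ) f) (hgeom : GeomAssumption Ω f) :
    ∃ p : ℕ, 0 < p ∧ ∃ w : Fin p → Euc d → ℝ,
      (∀ j, ContDiff ℝ (s : ℕ) (w j)) ∧
      ∀ x ∈ Ω, f x - sInf (f '' closure Ω) = ∑ j, (w j x) ^ 2 := by
  obtain ⟨-, -, hZΩ, hHess⟩ := hgeom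
  set m := sInf (f '' closure Ω)
  have hK : IsCompact (closure Ω) := hΩb.isCompact_closure
  have hle : ∀ x ∈ closure Ω, m ≤ f x := fun x hx =>
    csInf_le (hK.image hf.continuous).bddBelow (mem_image_of_mem f hx)
  have hf0 : ContDiff ℝ s f := hf.of_le (by norm_cast; omega)
  have hloc : ∀ x ∈ closure Ω, LocallySumSq s (fun y => f y - m) x := by
    intro x hx
    rcases (hle x hx).lt_or_eq with h | h
    · exact locallySumSq_of_pos (hf0.sub contDiff_const) (sub_pos.2 h)
    · have hxZ : x ∈ minimizerSet Ω f := ⟨hx, h.symm⟩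
      have hmin : IsLocalMin f x := by
        filter_upwards [hΩo.mem_nhds (hZΩ hxZ)] with y hy
        exact h ▸ hle y (subset_closure hy)
      rw [h]
      refine locallySumSq_of_isLocalMin hf hmin fun v hv => ?_
      simpa [iteratedFDeriv_two_apply] using hHess x hxZ v hv
  obtain ⟨p, w, hw, hsum⟩ := hK.exists_sum_sq hloc
  refine ⟨p + 1, p.succ_pos, Fin.cons 0 w, fun j => ?_, fun x hx => ?_⟩
  · refine Fin.cases ?_ (fun j => ?_) j
    · exact contDiff_const
    · simpa using hw j
  · simpa [Fin.sum_univ_succ] using hsum x (subset_closure hx)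
end
end

section
/- Let Ω ⊆ ℝ^d, ζ ∈ Ω, f : ℝ^d → ℝ, f* = f(ζ), and suppose there exists β > 0 with f(x) − f* ≥ (β/2)·‖x − ζ‖² for all x ∈ Ω. Let 0 < ν < β. Consider the feasible set A = {(c, z) ∈ ℝ × ℝ^d : f(x) − (ν/2)‖x‖² + ν·⟨x, z⟩ − c ≥ 0 for all x ∈ Ω} and the objective F(c, z) = c − (ν/2)‖z‖². Then the pair (c*, z*) := (f* + (ν/2)‖ζ‖², ζ) belongs to A, F(c*, z*) = f* ≥ F(c, z) for every (c, z) ∈ A, and (c*, z*) is the unique maximizer: any (c, z) ∈ A with F(c, z) = F(c*, z*) satisfies (c, z) = (c*, z*). -/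
open Metric Set
open scoped RealInnerProductSpace

noncomputable section

/-- Suppose `f` dominates the quadratic `(β/2)‖x − ζ‖²` above its value
`f* = f ζ` on `Ω ∋ ζ`, and let `0 < ν < β`.  Among all pairs `(c, z)` such that the
parabola `x ↦ (ν/2)‖x‖² − ν⟨x, z⟩ + c` lies below `f` on `Ω`, the objective
`F(c, z) = c − (ν/2)‖z‖²` (the height of the vertex) is uniquely maximized at
`(c*, z*) = (f* + (ν/2)‖ζ‖², ζ)`, which is feasible, with optimal value `f*`. -/
theorem parabola_unique_max {d : ℕ}
    (Ω : Set (Euc d)) (ζ : Euc d) (hζ : ζ ∈ Ω) (f : Euc d → ℝ)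
    (β ν : ℝ) (hβ : 0 < β)
    (hlow : ∀ x ∈ Ω, β / 2 * ‖x - ζ‖ ^ 2 ≤ f x - f ζ)
    (hν : 0 < ν) (hνβ : ν < β) :
    (∀ x ∈ Ω, 0 ≤ f x - ν / 2 * ‖x‖ ^ 2 + ν * ⟪x, ζ⟫ - (f ζ + ν / 2 * ‖ζ‖ ^ 2)) ∧
    (f ζ + ν / 2 * ‖ζ‖ ^ 2) - ν / 2 * ‖ζ‖ ^ 2 = f ζ ∧
    (∀ (c : ℝ) (z : Euc d),
      (∀ x ∈ Ω, 0 ≤ f x - ν / 2 * ‖x‖ ^ 2 + ν * ⟪x, z⟫ - c) →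
      c - ν / 2 * ‖z‖ ^ 2 ≤ f ζ) ∧
    (∀ (c : ℝ) (z : Euc d),
      (∀ x ∈ Ω, 0 ≤ f x - ν / 2 * ‖x‖ ^ 2 + ν * ⟪x, z⟫ - c) →
      c - ν / 2 * ‖z‖ ^ 2 = f ζ → c = f ζ + ν / 2 * ‖ζ‖ ^ 2 ∧ z = ζ) := by
  have vertex_le : ∀ (c : ℝ) (z : Euc d),
      (∀ x ∈ Ω, 0 ≤ f x - ν / 2 * ‖x‖ ^ 2 + ν * ⟪x, z⟫ - c) →
      c - ν / 2 * ‖z‖ ^ 2 + ν / 2 * ‖ζ - z‖ ^ 2 ≤ f ζ := by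
    intro c z hz
    have hzζ := hz ζ hζ
    rw [norm_sub_sq_real]
    linarith
  refine ⟨fun x hx => ?_, by ring, fun c z hz => ?_, fun c z hz hc => ?_⟩
  · have hmono : ν / 2 * ‖x - ζ‖ ^ 2 ≤ β / 2 * ‖x - ζ‖ ^ 2 := by gcongr
    have hx' := hmono.trans (hlow x hx)
    rw [norm_sub_sq_real] at hx'
    linarith
  · have : 0 ≤ ν / 2 * ‖ζ - z‖ ^ 2 := by positivity
    linarith [vertex_le c z hz]
  · have hle : ν / 2 * ‖ζ - z‖ ^ 2 ≤ 0 := by linarith [vertex_le c z hz]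
    have hsq : ‖ζ - z‖ ^ 2 = 0 :=
      le_antisymm (nonpos_of_mul_nonpos_right hle (half_pos hν)) (sq_nonneg _)
    obtain rfl : ζ = z := sub_eq_zero.mp (norm_eq_zero.mp (pow_eq_zero_iff two_ne_zero |>.mp hsq))
    exact ⟨by linarith, rfl⟩
end
end

section
/- Let d ∈ ℕ₊, let u ∈ ℝ^d be a unit vector, α ∈ [0, π/2], x₀ ∈ ℝ^d and t > 0. Define the cone C^α_{x₀,u,t} = {x ∈ B_t(x₀) : x ≠ x₀ and ⟨x − x₀, u⟩ ≥ ‖x − x₀‖·cos α}. Then the d-dimensional Lebesgue measure of the cone satisfies vol(C^α_{x₀,u,t}) ≥ (√π·sin α)^{d−1}·(t·cos α)^d / (d·Γ((d+1)/2)). -/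
open Metric Set MeasureTheory
open scoped RealInnerProductSpace

noncomputable section

/-- Two vectors of equal norm in real inner product spaces of the same dimension correspond under some
linear isometry equivalence. -/
lemma exists_linearIsometryEquiv_map_eq {E F : Type*}
    [NormedAddCommGroup E] [InnerProductSpace ℝ E] [FiniteDimensional ℝ E]
    [NormedAddCommGroup F] [InnerProductSpace ℝ F] [FiniteDimensional ℝ F]
    (h : Module.finrank ℝ E = Module.finrank ℝ F) {v : E} {u : F} (huv : ‖v‖ = ‖u‖) :
    ∃ φ : E ≃ₗᵢ[ℝ] F, φ v = u := by
  let ψ : E ≃ₗᵢ[ℝ] F :=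
    (stdOrthonormalBasis ℝ E).equiv (stdOrthonormalBasis ℝ F) (finCongr h)
  refine ⟨ψ.trans (ℝ ∙ (ψ v - u))ᗮ.reflection, ?_⟩
  exact Submodule.reflection_sub (by simpa using huv)

lemma volume_closedBall_zero_eq (n : ℕ) {r : ℝ} (hr : 0 ≤ r) :
    volume (closedBall (0 : Euc n) r) =
      ENNReal.ofReal ((√Real.pi * r) ^ n / Real.Gamma ((n : ℝ) / 2 + 1)) := by
  rcases Nat.eq_zero_or_pos n with rfl | hn
  · have : closedBall (0 : Euc 0) r = univ := by
      ext x
      simp [Subsingleton.elim x 0, hr]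
    rw [this, volume_euclideanSpace_eq_dirac]
    simp
  · have : Nonempty (Fin n) := ⟨⟨0, hn⟩⟩
    rw [EuclideanSpace.volume_closedBall, Fintype.card_fin, ← ENNReal.ofReal_pow hr,
      ← ENNReal.ofReal_mul (by positivity), mul_pow]
    congr 1
    ring

lemma lintegral_Ioo_const_mul_pow (n : ℕ) {c h : ℝ} (hc : 0 ≤ c) (hh : 0 ≤ h) :
    ∫⁻ s in Ioo 0 h, ENNReal.ofReal (c * s ^ n) =
      ENNReal.ofReal (c * h ^ (n + 1) / (n + 1)) := by
  have hcont : Continuous fun s : ℝ => c * s ^ n := by fun_prop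
  rw [setLIntegral_congr (Ioo_ae_eq_Ioc (a := (0 : ℝ)) (b := h)),
    ← ofReal_integral_eq_lintegral_ofReal (hcont.integrableOn_Ioc), ←
    intervalIntegral.integral_of_le hh, intervalIntegral.integral_const_mul, integral_pow]
  · congr 1
    simp
    ring
  · refine (ae_restrict_iff' measurableSet_Ioc).2 (.of_forall fun s hs => ?_)
    have := hs.1
    simp only [Pi.zero_apply]
    positivity

/-- The volume of a right circular cone of height `h` and slope `b`. -/
lemma volume_rightCircularCone (n : ℕ) {b h : ℝ} (hb : 0 ≤ b) (hh : 0 ≤ h) :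
    volume {p : ℝ × Euc n | (0 < p.1 ∧ p.1 < h) ∧ ‖p.2‖ ≤ p.1 * b} =
      ENNReal.ofReal ((√Real.pi * b) ^ n * h ^ (n + 1) /
        ((n + 1) * Real.Gamma ((n : ℝ) / 2 + 1))) := by
  have hΓ : 0 < Real.Gamma ((n : ℝ) / 2 + 1) := Real.Gamma_pos_of_pos (by positivity)
  have hmeas : MeasurableSet {p : ℝ × Euc n | (0 < p.1 ∧ p.1 < h) ∧ ‖p.2‖ ≤ p.1 * b} := by
    measurability
  rw [Measure.volume_eq_prod, Measure.prod_apply hmeas]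
  have hslice : (fun s : ℝ => volume (Prod.mk s ⁻¹'
      {p : ℝ × Euc n | (0 < p.1 ∧ p.1 < h) ∧ ‖p.2‖ ≤ p.1 * b})) =
      (Ioo 0 h).indicator fun s => ENNReal.ofReal
        ((√Real.pi * b) ^ n / Real.Gamma ((n : ℝ) / 2 + 1) * s ^ n) := by
    funext s
    by_cases hs : s ∈ Ioo 0 h
    · have hset : Prod.mk s ⁻¹' {p : ℝ × Euc n | (0 < p.1 ∧ p.1 < h) ∧ ‖p.2‖ ≤ p.1 * b} =
          closedBall 0 (s * b) := by
        ext w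
        simp [hs.1, hs.2]
      rw [indicator_of_mem hs, hset, volume_closedBall_zero_eq n (mul_nonneg hs.1.le hb)]
      congr 1
      ring
    · have hset : Prod.mk s ⁻¹' {p : ℝ × Euc n | (0 < p.1 ∧ p.1 < h) ∧ ‖p.2‖ ≤ p.1 * b} =
          ∅ := by
        ext w
        simp only [mem_preimage, mem_ofPred_eq, mem_empty_iff_false, iff_false]
        exact fun hw => hs hw.1
      rw [indicator_of_notMem hs, hset, measure_empty]
  rw [hslice, lintegral_indicator measurableSet_Ioo,
    lintegral_Ioo_const_mul_pow n (by positivity) hh]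
  congr 1
  field_simp

/-- A point at height `s` and distance `r ≤ s sin α` from the axis lies within the cone of
aperture `α`, and within the ball of radius `t` when `s < t cos α`. -/
lemma sqrt_sq_add_sq_mem_cone {α s r t : ℝ} (hs : 0 < s) (ht : 0 < t)
    (hr0 : 0 ≤ r) (hst : s < t * Real.cos α) (hr : r ≤ s * Real.sin α) :
    √(s ^ 2 + r ^ 2) < t ∧ √(s ^ 2 + r ^ 2) * Real.cos α ≤ s := by
  have hr2 : r ^ 2 ≤ s ^ 2 * Real.sin α ^ 2 := by
    rw [← mul_pow]
    gcongr
  have hst2 : s ^ 2 < t ^ 2 * Real.cos α ^ 2 := by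
    rw [← mul_pow]
    gcongr
  have hsq := Real.sin_sq_add_cos_sq α
  have hprod : (1 + Real.sin α ^ 2) * Real.cos α ^ 2 ≤ 1 := by
    nlinarith [sq_nonneg (Real.sin α ^ 2)]
  constructor
  · rw [Real.sqrt_lt' ht]
    nlinarith [mul_le_mul_of_nonneg_left hprod (sq_nonneg t),
      mul_lt_mul_of_pos_right hst2 (show 0 < 1 + Real.sin α ^ 2 by positivity)]
  · refine abs_le_of_sq_le_sq' ?_ hs.le |>.2
    rw [mul_pow, Real.sq_sqrt (by positivity)]
    nlinarith [mul_le_mul_of_nonneg_left hprod (sq_nonneg s),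
      mul_le_mul_of_nonneg_right hr2 (sq_nonneg (Real.cos α))]

/-- Lower bound on the volume of the cone with apex `x₀`, direction `u`
(a unit vector), radius `t` and aperture `α`:
`vol(C^α_{x₀,u,t}) ≥ (√π·sin α)^{d−1}·(t·cos α)^d / (d·Γ((d+1)/2))`. -/
theorem cone_volume_lower_bound {d : ℕ} (hd : 0 < d)
    (u : Euc d) (hu : ‖u‖ = 1) (α : ℝ) (hα0 : 0 ≤ α) (hα : α ≤ Real.pi / 2)
    (x₀ : Euc d) (t : ℝ) (ht : 0 < t) :
    ENNReal.ofReal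
        ((Real.sqrt Real.pi * Real.sin α) ^ (d - 1) * (t * Real.cos α) ^ d /
          (d * Real.Gamma (((d : ℝ) + 1) / 2))) ≤
      volume {x : Euc d | x ∈ ball x₀ t ∧ x ≠ x₀ ∧
        ‖x - x₀‖ * Real.cos α ≤ ⟪x - x₀, u⟫} := by
  obtain ⟨n, rfl⟩ : ∃ n, d = n + 1 := ⟨d - 1, by omega⟩
  have hcos : 0 ≤ Real.cos α := Real.cos_nonneg_of_mem_Icc ⟨by linarith, hα⟩
  have hsin : 0 ≤ Real.sin α := Real.sin_nonneg_of_nonneg_of_le_pi hα0 (by linarith)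
  obtain ⟨φ, hφ⟩ := exists_linearIsometryEquiv_map_eq (E := WithLp 2 (ℝ × Euc n))
    (F := Euc (n + 1)) (v := WithLp.toLp 2 (1, 0)) (u := u)
    (by
      rw [(WithLp.linearEquiv 2 ℝ (ℝ × Euc n)).finrank_eq]
      simp [add_comm])
    (by rw [hu, WithLp.prod_norm_eq_of_L2]; simp)
  have hpres : MeasurePreserving
      (fun p : ℝ × Euc n => φ (WithLp.toLp 2 p) + x₀) volume volume :=
    (measurePreserving_add_right volume x₀).comp
      (φ.measurePreserving.comp (WithLp.volume_preserving_toLp ℝ (Euc n)))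
  have hexp : ((n + 1 : ℕ) + 1 : ℝ) / 2 = (n : ℝ) / 2 + 1 := by
    push_cast
    ring
  rw [hexp, Nat.add_sub_cancel, Nat.cast_add_one,
    ← volume_rightCircularCone n hsin (mul_nonneg ht.le hcos)]
  refine le_trans (measure_mono ?_)
    ((Measure.le_map_apply hpres.measurable.aemeasurable _).trans_eq (by rw [hpres.map_eq]))
  rintro ⟨s, w⟩ ⟨⟨hs, hst⟩, hw⟩
  have hnorm : ‖φ (WithLp.toLp 2 (s, w))‖ = √(s ^ 2 + ‖w‖ ^ 2) := by
    rw [φ.norm_map, WithLp.prod_norm_eq_of_L2]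
    simp
  have hinner : ⟪φ (WithLp.toLp 2 (s, w)), u⟫ = s := by
    rw [← hφ, φ.inner_map_map, WithLp.prod_inner_apply]
    simp
  obtain ⟨hlt, hle⟩ := sqrt_sq_add_sq_mem_cone hs ht (norm_nonneg w) hst hw
  simp only [mem_preimage, mem_ofPred_eq, add_sub_cancel_right, mem_ball, dist_eq_norm, hnorm,
    hinner]
  refine ⟨hlt, fun h => ?_, hle⟩
  rw [add_eq_right] at h
  rw [h, inner_zero_left] at hinner
  exact hs.ne hinner
end
end

section
/- Let d ∈ ℕ₊, let u : ℝ^d → ℝ be continuous, nonnegative and Lebesgue-integrable, and let g : [0,∞) → (0,∞) be nonincreasing with u(x) ≤ g(‖x‖) for all x ∈ ℝ^d. Then for every x ∈ ℝ^d, 0 ≤ (u⋆u)(x) ≤ 2·‖u‖_{L¹(ℝ^d)}·g(‖x‖/2). Consequently, if in addition u(x) > 0 for all x, then sup_{x∈ℝ^d} (u⋆u)(x)/u(x) ≤ 2·‖u‖_{L¹(ℝ^d)}·sup_{x∈ℝ^d} g(‖x‖/2)/u(x). -/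
open Metric Set MeasureTheory
open scoped RealInnerProductSpace

noncomputable section

/-- A product of values at `y` and `x - y` is controlled by a radial nonincreasing majorant,
since one of the two points has norm at least `‖x‖ / 2`. -/
lemma mul_sub_le_of_radial_majorant {E : Type*} [NormedAddCommGroup E] {u : E → ℝ} {g : ℝ → ℝ}
    (hu : ∀ x, 0 ≤ u x) (hg : AntitoneOn g (Set.Ici 0)) (hug : ∀ x, u x ≤ g ‖x‖) (x y : E) :
    u y * u (x - y) ≤ (u y + u (x - y)) * g (‖x‖ / 2) := by
  have far : ∀ z : E, ‖x‖ / 2 ≤ ‖z‖ → u z ≤ g (‖x‖ / 2) := fun z hz =>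
    (hug z).trans (hg (Set.mem_Ici.2 (by positivity)) (Set.mem_Ici.2 (norm_nonneg z)) hz)
  rcases le_total (‖x‖ / 2) ‖y‖ with h | h
  · have hy := far y h
    nlinarith [hu y, hu (x - y), mul_le_mul_of_nonneg_right hy (hu (x - y)),
      mul_nonneg (hu y) ((hu y).trans hy)]
  · have hxy := far (x - y) (by linarith [norm_sub_norm_le x y])
    nlinarith [hu y, hu (x - y), mul_le_mul_of_nonneg_left hxy (hu y),
      mul_nonneg (hu (x - y)) ((hu (x - y)).trans hxy)]

/-- If `u : ℝ^d → ℝ` is continuous, nonnegative and integrable and is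
dominated by a nonincreasing positive radial profile `g`, then
`0 ≤ (u⋆u)(x) ≤ 2·‖u‖_{L¹}·g(‖x‖/2)` for all `x`; consequently, if `u > 0` everywhere,
then `(u⋆u)(x)/u(x) ≤ 2·‖u‖_{L¹}·C` for any upper bound `C` of `x ↦ g(‖x‖/2)/u(x)`. -/
theorem conv_upper_bound {d : ℕ} (hd : 0 < d)
    (u : Euc d → ℝ) (hu_cont : Continuous u) (hu_nonneg : ∀ x, 0 ≤ u x)
    (hu_int : Integrable u)
    (g : ℝ → ℝ) (hg_pos : ∀ s : ℝ, 0 ≤ s → 0 < g s)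
    (hg_anti : AntitoneOn g (Set.Ici 0))
    (hub : ∀ x, u x ≤ g ‖x‖) :
    (∀ x : Euc d,
      0 ≤ ∫ y, u y * u (x - y) ∧
      (∫ y, u y * u (x - y)) ≤ 2 * (∫ y, u y) * g (‖x‖ / 2)) ∧
    ((∀ x, 0 < u x) → ∀ C : ℝ, (∀ x, g (‖x‖ / 2) / u x ≤ C) →
      ∀ x, (∫ y, u y * u (x - y)) / u x ≤ 2 * (∫ y, u y) * C) := by
  have bound : ∀ x : Euc d,
      (∫ y, u y * u (x - y)) ≤ 2 * (∫ y, u y) * g (‖x‖ / 2) := fun x => by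
    have hint : Integrable fun y => u (x - y) := hu_int.comp_sub_left x
    calc (∫ y, u y * u (x - y))
        ≤ ∫ y, (u y + u (x - y)) * g (‖x‖ / 2) :=
          integral_mono_of_nonneg (.of_forall fun y => mul_nonneg (hu_nonneg y) (hu_nonneg _))
            ((hu_int.add hint).mul_const _)
            (.of_forall fun y => mul_sub_le_of_radial_majorant hu_nonneg hg_anti hub x y)
      _ = 2 * (∫ y, u y) * g (‖x‖ / 2) := by
          rw [integral_mul_const, integral_add hu_int hint,
            integral_sub_left_eq_self u volume x, two_mul]
  refine ⟨fun x => ⟨integral_nonneg fun y => mul_nonneg (hu_nonneg y) (hu_nonneg _), bound x⟩,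
    fun hpos C hC x => ?_⟩
  calc (∫ y, u y * u (x - y)) / u x
      ≤ 2 * (∫ y, u y) * g (‖x‖ / 2) / u x := div_le_div_of_nonneg_right (bound x) (hpos x).le
    _ = 2 * (∫ y, u y) * (g (‖x‖ / 2) / u x) := mul_div_assoc _ _ _
    _ ≤ 2 * (∫ y, u y) * C :=
        mul_le_mul_of_nonneg_left (hC x) (mul_nonneg two_pos.le (integral_nonneg hu_nonneg))
end
end

section
/- Let d ∈ ℕ₊ and let w : ℝ^d → (0,∞) and f, g : ℝ^d → ℝ be Lebesgue-measurable, with f²/w and g²/w integrable. Let Q = ess sup_{ω∈ℝ^d} (w⋆w)(ω)/w(ω), where (w⋆w)(ω) = ∫_{ℝ^d} w(σ)·w(ω−σ) dσ. Then ∫_{ℝ^d} (∫_{ℝ^d} |f(σ)|·|g(ω−σ)| dσ)² / w(ω) dω ≤ Q · (∫_{ℝ^d} f(σ)²/w(σ) dσ) · (∫_{ℝ^d} g(σ)²/w(σ) dσ), where both sides are interpreted in [0, ∞]. -/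
open Metric Set MeasureTheory
open scoped RealInnerProductSpace ENNReal

noncomputable section

/-- The Cauchy–Schwarz inequality for the lower Lebesgue integral, in squared form. -/
theorem sq_lintegral_mul_le {α : Type*} [MeasurableSpace α] (μ : Measure α) {a b : α → ℝ≥0∞}
    (ha : AEMeasurable a μ) (hb : AEMeasurable b μ) :
    (∫⁻ x, a x * b x ∂μ) ^ 2 ≤ (∫⁻ x, a x ^ 2 ∂μ) * ∫⁻ x, b x ^ 2 ∂μ := by
  have h := ENNReal.lintegral_mul_le_Lp_mul_Lq μ Real.HolderConjugate.two_two ha hb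
  simp only [Pi.mul_apply, ENNReal.rpow_two] at h
  have hsq (y : ℝ≥0∞) : (y ^ (1 / (2 : ℝ))) ^ 2 = y := by
    rw [← ENNReal.rpow_two, ← ENNReal.rpow_mul]
    norm_num
  calc (∫⁻ x, a x * b x ∂μ) ^ 2 ≤ _ := pow_le_pow_left' h 2
    _ = _ := by rw [mul_pow, hsq, hsq]

/-- The integral of a convolution is the product of the integrals. -/
theorem lintegral_lintegral_mul_sub {G : Type*} [AddCommGroup G] [MeasurableSpace G]
    [MeasurableAdd₂ G] [MeasurableNeg G] (μ : Measure G) [SFinite μ] [μ.IsAddRightInvariant]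
    {u v : G → ℝ≥0∞} (hu : Measurable u) (hv : Measurable v) :
    ∫⁻ x, ∫⁻ y, u y * v (x - y) ∂μ ∂μ = (∫⁻ y, u y ∂μ) * ∫⁻ x, v x ∂μ := by
  have hm : Measurable fun p : G × G => u p.2 * v (p.1 - p.2) := by fun_prop
  rw [lintegral_lintegral_swap hm.aemeasurable, ← lintegral_mul_const _ hu]
  refine lintegral_congr fun y => ?_
  rw [lintegral_const_mul _ (by fun_prop), lintegral_sub_right_eq_self v y]

/-- Cauchy–Schwarz for a convolution, weighted by `w`. -/
theorem sq_lintegral_conv_le {G : Type*} [AddCommGroup G] [MeasurableSpace G]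
    [MeasurableAdd₂ G] [MeasurableNeg G] (μ : Measure G) {w f g : G → ℝ}
    (hw_pos : ∀ x, 0 < w x) (hw : Measurable w) (hf : Measurable f) (hg : Measurable g) (x : G) :
    (∫⁻ y, ENNReal.ofReal (|f y| * |g (x - y)|) ∂μ) ^ 2 ≤
      (∫⁻ y, ENNReal.ofReal (w y * w (x - y)) ∂μ) *
        ∫⁻ y, ENNReal.ofReal (f y ^ 2 / w y) * ENNReal.ofReal (g (x - y) ^ 2 / w (x - y)) ∂μ := by
  have hW (y : G) : 0 < w y * w (x - y) := mul_pos (hw_pos _) (hw_pos _)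
  convert sq_lintegral_mul_le μ
    (a := fun y => ENNReal.ofReal (√(w y * w (x - y))))
    (b := fun y => ENNReal.ofReal (|f y| * |g (x - y)| / √(w y * w (x - y))))
    (by fun_prop) (by fun_prop) using 5 with y y y
  · rw [← ENNReal.ofReal_mul (Real.sqrt_nonneg _),
      mul_div_cancel₀ _ (Real.sqrt_pos.2 (hW y)).ne']
  · rw [← ENNReal.ofReal_pow (Real.sqrt_nonneg _), Real.sq_sqrt (hW y).le]
  · rw [← ENNReal.ofReal_pow (by positivity), div_pow, Real.sq_sqrt (hW y).le, mul_pow, sq_abs,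
      sq_abs, ← ENNReal.ofReal_mul (div_nonneg (sq_nonneg _) (hw_pos y).le), div_mul_div_comm]

/-- Weighted `L²` bound for convolutions: for a positive measurable
weight `w` and measurable `f, g` with `f²/w` and `g²/w` integrable,
`∫ (∫ |f(σ)||g(ω−σ)| dσ)²/w(ω) dω ≤ Q · (∫ f²/w) · (∫ g²/w)` where
`Q = ess sup (w⋆w)/w`, all quantities interpreted in `[0,∞]`. -/
theorem weighted_conv_bound {d : ℕ} (hd : 0 < d)
    (w : Euc d → ℝ) (hw_pos : ∀ x, 0 < w x) (hw_meas : Measurable w)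
    (f g : Euc d → ℝ) (hf_meas : Measurable f) (hg_meas : Measurable g)
    (hf_int : Integrable (fun x => f x ^ 2 / w x))
    (hg_int : Integrable (fun x => g x ^ 2 / w x)) :
    ∫⁻ ω, (∫⁻ σ, ENNReal.ofReal (|f σ| * |g (ω - σ)|)) ^ 2 / ENNReal.ofReal (w ω) ≤
      essSup
          (fun ω => (∫⁻ σ, ENNReal.ofReal (w σ * w (ω - σ))) / ENNReal.ofReal (w ω))
          volume *
        (∫⁻ σ, ENNReal.ofReal (f σ ^ 2 / w σ)) *
        (∫⁻ σ, ENNReal.ofReal (g σ ^ 2 / w σ)) := by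
  have hF : Measurable fun x => ENNReal.ofReal (f x ^ 2 / w x) := by fun_prop
  have hG : Measurable fun x => ENNReal.ofReal (g x ^ 2 / w x) := by fun_prop
  rw [mul_assoc, ← lintegral_lintegral_mul_sub volume hF hG,
    ← lintegral_const_mul _ (Measurable.lintegral_prod_right' (f := fun p : Euc d × Euc d =>
      ENNReal.ofReal (f p.2 ^ 2 / w p.2) *
        ENNReal.ofReal (g (p.1 - p.2) ^ 2 / w (p.1 - p.2))) (by fun_prop))]
  refine lintegral_mono_ae ?_
  filter_upwards [ENNReal.ae_le_essSup fun ω =>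
    (∫⁻ σ, ENNReal.ofReal (w σ * w (ω - σ))) / ENNReal.ofReal (w ω)] with ω hω
  calc _ ≤ _ := ENNReal.div_le_div_right
        (sq_lintegral_conv_le volume hw_pos hw_meas hf_meas hg_meas ω) _
    _ = _ := ENNReal.mul_div_right_comm
    _ ≤ _ := mul_le_mul_left hω _
end
end

section
/- In the feature-map setup, let g : Ω → ℝ admit a trace-class sum-of-squares representation, i.e. there is a sequence (wⱼ)_{j∈ℕ} in H with T := ∑ⱼ ‖wⱼ‖² < ∞ and g(x) = ∑ⱼ ⟨wⱼ, φ(x)⟩² for all x ∈ Ω. Then there exists a symmetric positive semidefinite matrix B ∈ ℝ^{n×n} with tr(B) ≤ T and Φᵢᵀ B Φᵢ = g(xᵢ) for every i ∈ [n]. -/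
open Metric Set Matrix
open scoped RealInnerProductSpace

noncomputable section

/-- The family `v` orthonormalized by the inverse of a factor `R` of its Gram matrix `Rᵀ * R`. -/
theorem exists_orthonormal_of_gram_factor {n : Type*} [Fintype n] [DecidableEq n]
    {H : Type*} [NormedAddCommGroup H] [InnerProductSpace ℝ H] {v : n → H}
    (hv : LinearIndependent ℝ v) {R : Matrix n n ℝ} (hR : Rᵀ * R = gram ℝ v) :
    ∃ e : n → H, Orthonormal ℝ e ∧ ∀ i, v i = ∑ k, R k i • e k := by
  have hdet : IsUnit R.det := by
    have h := det_gram_ne_zero_iff_linearIndependent.2 hv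
    rw [← hR, det_mul] at h
    exact (right_ne_zero_of_mul h).isUnit
  refine ⟨fun k => ∑ i, R⁻¹ i k • v i, ?_, fun i => ?_⟩
  · rw [← gram_eq_one_iff_orthonormal (𝕜 := ℝ)]
    have h : R⁻¹ᵀ * (Rᵀ * R) * R⁻¹ = 1 := by
      rw [← Matrix.mul_assoc, ← transpose_mul, mul_nonsing_inv R hdet, transpose_one,
        Matrix.one_mul, mul_nonsing_inv R hdet]
    rw [← h, hR]
    ext k l
    simp only [gram_apply, sum_inner, inner_sum, real_inner_smul_left, real_inner_smul_right,
      mul_apply, transpose_apply, Finset.sum_mul]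
    refine Finset.sum_congr rfl fun i _ => Finset.sum_congr rfl fun j _ => ?_
    ring
  · have h : ∀ j, ∑ k, R⁻¹ j k * R k i = (1 : Matrix n n ℝ) j i := fun j => by
      rw [← mul_apply, nonsing_inv_mul R hdet]
    simp only [Finset.smul_sum, smul_smul]
    rw [Finset.sum_comm]
    simp only [← Finset.sum_smul, mul_comm (R _ i), h, one_apply, ite_smul, one_smul, zero_smul,
      Finset.sum_ite_eq', Finset.mem_univ, if_true]

theorem summable_inner_mul_inner {H : Type*} [NormedAddCommGroup H] [InnerProductSpace ℝ H]
    {ι : Type*} {w : ι → H} (hw : Summable fun j => ‖w j‖ ^ 2) (a b : H) :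
    Summable fun j => ⟪w j, a⟫ * ⟪w j, b⟫ := by
  refine Summable.of_norm_bounded (hw.mul_right (‖a‖ * ‖b‖)) fun j => ?_
  rw [norm_mul]
  calc ‖⟪w j, a⟫‖ * ‖⟪w j, b⟫‖ ≤ (‖w j‖ * ‖a‖) * (‖w j‖ * ‖b‖) := by
        gcongr <;> exact norm_inner_le_norm _ _
    _ = ‖w j‖ ^ 2 * (‖a‖ * ‖b‖) := by ring

/-- The quadratic form of the matrix of `∑ⱼ wⱼ ⊗ wⱼ` in the family `e`. -/
theorem dotProduct_mulVec_tsum_inner_mul_inner {n : Type*} [Fintype n]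
    {H : Type*} [NormedAddCommGroup H] [InnerProductSpace ℝ H]
    {ι : Type*} {w : ι → H} (hw : Summable fun j => ‖w j‖ ^ 2) (e : n → H) (v : n → ℝ) :
    v ⬝ᵥ (of fun k l => ∑' j, ⟪w j, e k⟫ * ⟪w j, e l⟫) *ᵥ v
      = ∑' j, ⟪w j, ∑ k, v k • e k⟫ ^ 2 := by
  symm
  have h : HasSum (fun j => ∑ k, v k * ∑ l, (⟪w j, e k⟫ * ⟪w j, e l⟫) * v l)
      (∑ k, v k * ∑ l, (∑' j, ⟪w j, e k⟫ * ⟪w j, e l⟫) * v l) :=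
    hasSum_sum fun k _ => (hasSum_sum fun l _ =>
      (summable_inner_mul_inner hw (e k) (e l)).hasSum.mul_right (v l)).mul_left (v k)
  refine Eq.trans (tsum_congr fun j => ?_) h.tsum_eq
  simp only [inner_sum, real_inner_smul_right]
  rw [sq, Finset.sum_mul_sum]
  simp only [Finset.mul_sum]
  refine Finset.sum_congr rfl fun k _ => Finset.sum_congr rfl fun l _ => ?_
  ring

/-- In the feature-map setup, if `g` admits a trace-class
sum-of-squares representation `g(x) = ∑ⱼ ⟨wⱼ, φ(x)⟩²` on `Ω` with
`T = ∑ⱼ ‖wⱼ‖² < ∞`, then there is a positive semidefinite matrix `B ∈ ℝ^{n×n}` with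
`tr(B) ≤ T` and `Φᵢᵀ B Φᵢ = g(xᵢ)` for all `i`. -/
theorem exists_finite_dim_B {d n : ℕ} (hn : 0 < n)
    {H : Type*} [NormedAddCommGroup H] [InnerProductSpace ℝ H]
    (Ω : Set (Euc d)) (φ : Euc d → H)
    (x : Fin n → Euc d) (hx : ∀ i, x i ∈ Ω)
    (hind : LinearIndependent ℝ (fun i => φ (x i)))
    (K R : Matrix (Fin n) (Fin n) ℝ)
    (hK : ∀ i j, K i j = ⟪φ (x i), φ (x j)⟫)
    (hR : R.transpose * R = K)
    (hRtri : R.BlockTriangular id)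
    (g : Euc d → ℝ) (w : ℕ → H)
    (hw : Summable fun j => ‖w j‖ ^ 2)
    (hg : ∀ y ∈ Ω, g y = ∑' j, ⟪w j, φ y⟫ ^ 2) :
    ∃ B : Matrix (Fin n) (Fin n) ℝ, B.PosSemidef ∧
      B.trace ≤ ∑' j, ‖w j‖ ^ 2 ∧
      ∀ i, (fun j => R j i) ⬝ᵥ B.mulVec (fun j => R j i) = g (x i) := by
  obtain ⟨e, he, hφ⟩ := exists_orthonormal_of_gram_factor hind
    (hR.trans (Matrix.ext fun i j => (hK i j).trans (gram_apply (fun i => φ (x i)) i j).symm))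
  refine ⟨of fun k l => ∑' j, ⟪w j, e k⟫ * ⟪w j, e l⟫, ?_, ?_, fun i => ?_⟩
  · refine PosSemidef.of_dotProduct_mulVec_nonneg ?_ fun v => ?_
    · ext k l
      simp [mul_comm]
    · rw [star_trivial, dotProduct_mulVec_tsum_inner_mul_inner hw]
      exact tsum_nonneg fun j => sq_nonneg _
  · have h := hasSum_sum (s := Finset.univ) fun k _ =>
      (summable_inner_mul_inner hw (e k) (e k)).hasSum
    refine hasSum_le (fun j => ?_) h hw.hasSum
    simpa [sq, real_inner_comm] using he.sum_inner_products_le (w j) (s := Finset.univ)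
  · rw [dotProduct_mulVec_tsum_inner_mul_inner hw, ← hφ, hg _ (hx i)]
end
end

section
/- Let H be a real Hilbert space, Ω a set, φ : Ω → H a map, and suppose Property (M) holds for some constant M ≥ 1. Let (σⱼ)_{j∈ℕ} be nonnegative reals with ∑ⱼ σⱼ < ∞, and let (uⱼ)_{j∈ℕ} and (vⱼ)_{j∈ℕ} be orthonormal families in H (the singular-value data of the trace-class operator A = ∑ⱼ σⱼ·uⱼ⊗vⱼ, whose nuclear norm is ‖A‖⋆ = ∑ⱼ σⱼ). Then there exists r_A ∈ H with ‖r_A‖ ≤ M·∑ⱼ σⱼ such that for every x ∈ Ω, ⟨r_A, φ(x)⟩ = ∑ⱼ σⱼ·⟨uⱼ, φ(x)⟩·⟨vⱼ, φ(x)⟩, the series converging absolutely. -/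
open Metric Set
open scoped RealInnerProductSpace

noncomputable section

/-- If `H` is a real Hilbert space, `φ : Ω → H` a map satisfying
Property (M) with constant `M ≥ 1` (products of the functions `⟨u, φ(·)⟩` are again of
this form, with norm control `M‖u‖‖v‖`), and `A = ∑ⱼ σⱼ·uⱼ⊗vⱼ` is given by its
singular-value data (`σⱼ ≥ 0` summable, `(uⱼ)`, `(vⱼ)` orthonormal), then the function
`x ↦ ⟨φ(x), A φ(x)⟩ = ∑ⱼ σⱼ⟨uⱼ,φ(x)⟩⟨vⱼ,φ(x)⟩` (an absolutely convergent series) is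
represented by some `r_A ∈ H` with `‖r_A‖ ≤ M·∑ⱼ σⱼ = M·‖A‖⋆`. -/
theorem repr_of_trace_class {Ω : Type*} {H : Type*}
    [NormedAddCommGroup H] [InnerProductSpace ℝ H] [CompleteSpace H]
    (φ : Ω → H) (M : ℝ) (hM : 1 ≤ M)
    (hpropM : ∀ u v : H, ∃ w : H, ‖w‖ ≤ M * ‖u‖ * ‖v‖ ∧
      ∀ x : Ω, ⟪w, φ x⟫ = ⟪u, φ x⟫ * ⟪v, φ x⟫)
    (σ : ℕ → ℝ) (hσ0 : ∀ j, 0 ≤ σ j) (hσ : Summable σ)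
    (u v : ℕ → H) (hu : Orthonormal ℝ u) (hv : Orthonormal ℝ v) :
    ∃ rA : H, ‖rA‖ ≤ M * ∑' j, σ j ∧
      ∀ x : Ω,
        Summable (fun j => |σ j * ⟪u j, φ x⟫ * ⟪v j, φ x⟫|) ∧
        ⟪rA, φ x⟫ = ∑' j, σ j * ⟪u j, φ x⟫ * ⟪v j, φ x⟫ := by
  choose w hw_norm hw using fun j => hpropM (u j) (v j)
  have hbound (j : ℕ) : ‖σ j • w j‖ ≤ M * σ j := by
    have hwM : ‖w j‖ ≤ M := by simpa [hu.1 j, hv.1 j] using hw_norm j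
    rw [norm_smul, Real.norm_of_nonneg (hσ0 j), mul_comm]
    exact mul_le_mul_of_nonneg_right hwM (hσ0 j)
  have hsum : Summable fun j => σ j • w j := .of_norm_bounded (hσ.mul_left M) hbound
  refine ⟨∑' j, σ j • w j, ?_, fun x => ?_⟩
  · rw [← tsum_mul_left]
    exact tsum_of_norm_bounded (hσ.mul_left M).hasSum hbound
  · have hx : HasSum (fun j => σ j * ⟪u j, φ x⟫ * ⟪v j, φ x⟫) ⟪∑' j, σ j • w j, φ x⟫ := by
      simpa [real_inner_comm _ (φ x), real_inner_smul_left, hw, mul_assoc] using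
        hsum.hasSum.mapL (innerSL ℝ (φ x))
    exact ⟨hx.summable.abs, hx.tsum_eq.symm⟩
end
end
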